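/- Let R be a commutative O-algebra with π-derivation δ_R, and let B be a commutative R-algebra with π-derivation δ compatible with δ_R, i.e. δ(u(r)) = u(δ_R(r)) for all r ∈ R, where u : R → B is the structure map. Let a_1, …, a_k ∈ B and suppose a ∈ [a_1, …, a_k] (i.e. a = F(a_1, …, a_k) for some centered polynomial F ∈ R[T_1, …, T_k]). Then δ(a) ∈ [a_1, …, a_k, δ(a_1), …, δ(a_k)], i.e. δ(a) = G(a_1, …, a_k, δ(a_1), …, δ(a_k)) for some centered polynomial G ∈ R[T_1, …, T_{2k}]. -/

import Mathlib

open MvPolynomial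

/-- A `π`-derivation on a commutative `O`-algebra `B`, relative to the polynomial
`C ∈ O[X,Y]` satisfying `π·C = X^q + Y^q - (X+Y)^q`. -/
def IsPiDeriv {O : Type*} [CommRing O] (π : O) (q : ℕ) (C : MvPolynomial (Fin 2) O)
    {B : Type*} [CommRing B] [Algebra O B] (δ : B → B) : Prop :=
  δ 1 = 0 ∧
  (∀ x y : B, δ (x + y) = δ x + δ y + MvPolynomial.aeval ![x, y] C) ∧
  (∀ x y : B, δ (x * y) = x ^ q * δ y + y ^ q * δ x + algebraMap O B π * δ x * δ y)

/-- A polynomial is centered if it vanishes when all variables are set to `0`. -/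
def Centered {R : Type*} [CommRing R] {σ : Type*} (F : MvPolynomial σ R) : Prop :=
  MvPolynomial.eval (fun _ => (0 : R)) F = 0

/-- If `a ∈ [a_1, …, a_k]`, then `δ(a) ∈ [a_1, …, a_k, δ(a_1), …, δ(a_k)]`. -/
theorem piDeriv_of_centered_mem
    {O R B : Type*} [CommRing O] [CommRing R] [CommRing B]
    [Algebra O R] [Algebra O B] [Algebra R B] [IsScalarTower O R B]
    (π : O) (hπ : π ∈ nonZeroDivisors O) (q : ℕ) (hq : 1 ≤ q)
    (C : MvPolynomial (Fin 2) O)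
    (hC : MvPolynomial.C π * C = X 0 ^ q + X 1 ^ q - (X 0 + X 1) ^ q)
    (δR : R → R) (hδR : IsPiDeriv π q C δR)
    (δ : B → B) (hδ : IsPiDeriv π q C δ)
    (hcomp : ∀ r : R, δ (algebraMap R B r) = algebraMap R B (δR r))
    (k : ℕ) (a : Fin k → B)
    (F : MvPolynomial (Fin k) R) (hF : Centered F) :
    ∃ G : MvPolynomial (Fin k ⊕ Fin k) R, Centered G ∧
      δ (MvPolynomial.aeval a F) =
        MvPolynomial.aeval (Sum.elim a fun i => δ (a i)) G := by
  have hC0 : MvPolynomial.eval (fun _ => (0 : O)) C = 0 := by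
    have h := congrArg (MvPolynomial.eval (fun _ => (0 : O))) hC
    have hq0 : q ≠ 0 := by omega
    simp [hq0] at h
    have h2 := (mul_left_mem_nonZeroDivisors_eq_zero_iff hπ).1 h
    simpa using h2
  have hCR : MvPolynomial.aeval ![(0 : R), 0] C = 0 := by
    have e : (![(0 : R), 0]) = algebraMap O R ∘ (fun _ => (0 : O)) := by
      funext i
      fin_cases i <;> simp
    rw [e, MvPolynomial.aeval_algebraMap_apply, MvPolynomial.aeval_eq_eval, hC0,
      map_zero]
  have hδ0 : δR 0 = 0 := by
    have h := hδR.2.1 0 0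
    rw [hCR] at h
    simpa using h
  have key : ∀ F : MvPolynomial (Fin k) R, ∃ G : MvPolynomial (Fin k ⊕ Fin k) R,
      MvPolynomial.aeval (fun _ => (0 : R)) G = δR (MvPolynomial.aeval (fun _ => (0 : R)) F) ∧
      δ (MvPolynomial.aeval a F) =
        MvPolynomial.aeval (Sum.elim a fun i => δ (a i)) G := by
    intro F
    induction F using MvPolynomial.induction_on with
    | C r => exact ⟨MvPolynomial.C (δR r), by simp, by simp [hcomp]⟩
    | add p p' hp hp' =>
      obtain ⟨g, hg, hg2⟩ := hp
      obtain ⟨g', hg', hg2'⟩ := hp'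
      have comp : ∀ {A : Type _} [CommRing A] [Algebra R A] [Algebra O A] [IsScalarTower O R A]
          (f : MvPolynomial (Fin k ⊕ Fin k) R →ₐ[R] A) (u v : MvPolynomial (Fin k ⊕ Fin k) R),
          f (MvPolynomial.aeval ![u, v] C) = MvPolynomial.aeval ![f u, f v] C := by
        intro A _ _ _ _ f u v
        have h := MvPolynomial.comp_aeval_apply (f := ![u, v]) (f.restrictScalars O) C
        have e : (fun i => (f.restrictScalars O) (![u, v] i)) = ![f u, f v] := by
          funext i
          fin_cases i <;> simp
        rw [e] at h
        exact h
      refine ⟨g + g' + MvPolynomial.aeval ![rename Sum.inl p, rename Sum.inl p'] C, ?_, ?_⟩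
      · have h := MvPolynomial.comp_aeval_apply
          (f := ![rename (Sum.inl : Fin k → Fin k ⊕ Fin k) p, rename Sum.inl p'])
          ((MvPolynomial.aeval (fun _ => (0 : R)) :
            MvPolynomial (Fin k ⊕ Fin k) R →ₐ[R] R).restrictScalars O) C
        rw [map_add, map_add, map_add, hδR.2.1, hg, hg']
        congr 1
        refine h.trans ?_
        congr 2
        funext i
        fin_cases i <;> simp [aeval_rename, Function.comp_def]
      · rw [map_add, map_add, map_add, hδ.2.1, hg2, hg2', comp]
        simp [aeval_rename]
    | mul_X p i hp =>
      obtain ⟨g, hg, hg2⟩ := hp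
      refine ⟨rename Sum.inl p ^ q * X (Sum.inr i) + X (Sum.inl i) ^ q * g +
        MvPolynomial.C (algebraMap O R π) * g * X (Sum.inr i), ?_, ?_⟩
      · have hq0 : q ≠ 0 := by omega
        simp [hq0, hδ0]
      · rw [map_mul, hδ.2.2, hg2]
        simp [aeval_rename, ← IsScalarTower.algebraMap_apply]
  obtain ⟨G, h1, h2⟩ := key F
  refine ⟨G, ?_, h2⟩
  unfold Centered at *
  rw [MvPolynomial.aeval_eq_eval, MvPolynomial.aeval_eq_eval] at h1
  rw [h1, hF, hδ0]
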